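/- For every n ≥ 1, the matrix M₁ of the duality symmetry U₁₁ satisfies M₁ · M₁ = (1/2)(T + T·F), where T is the permutation matrix of the cyclic shift and F the permutation matrix of the componentwise flip. In particular, on vectors invariant under the flip, M₁² acts as the cyclic shift. -/

import Mathlib

open Matrix

/-- `E_n(μ,ν) = Σ_{i ∈ ℤ/n} μ(i)·(ν(i+1) − ν(i))` for binary strings `μ, ν : ℤ/n → {0,1}`. -/
def Emat (n : ℕ) [NeZero n] (μ ν : ZMod n → Fin 2) : ℤ :=
  ∑ i : ZMod n, ((μ i : ℕ) : ℤ) * (((ν (i + 1) : ℕ) : ℤ) - ((ν i : ℕ) : ℤ))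

/-- The matrix `M₁` of the duality symmetry `U₁₁`, with entries
`M₁(ν,μ) = 2^{−(n+1)/2}·(−1)^{E_n(μ,ν)}`, indexed by binary strings on `ℤ/n`. -/
noncomputable def M1 (n : ℕ) [NeZero n] :
    Matrix (ZMod n → Fin 2) (ZMod n → Fin 2) ℝ :=
  fun ν μ => (2 : ℝ) ^ (-(((n : ℝ) + 1) / 2)) * (-1 : ℝ) ^ Emat n μ ν

/-- The permutation matrix `F` of the componentwise flip `μ ↦ 1−μ`. -/
def flipMat (n : ℕ) [NeZero n] : Matrix (ZMod n → Fin 2) (ZMod n → Fin 2) ℝ :=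
  fun ρ μ => if ρ = (fun i => 1 - μ i) then 1 else 0

/-- The permutation matrix `T` of the cyclic shift `μ ↦ σμ`, `(σμ)(i) = μ(i−1)`. -/
def shiftMat (n : ℕ) [NeZero n] : Matrix (ZMod n → Fin 2) (ZMod n → Fin 2) ℝ :=
  fun ρ μ => if ρ = (fun i => μ (i - 1)) then 1 else 0

lemma Emat_eq_sum_diff_left (n : ℕ) [NeZero n] (μ ν : ZMod n → Fin 2) :
    Emat n μ ν = ∑ i : ZMod n,
      ((ν i : ℕ) : ℤ) * (((μ (i - 1) : ℕ) : ℤ) - ((μ i : ℕ) : ℤ)) := by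
  have h : ∑ i : ZMod n, ((μ i : ℕ) : ℤ) * ((ν (i + 1) : ℕ) : ℤ) =
      ∑ i : ZMod n, ((μ (i - 1) : ℕ) : ℤ) * ((ν i : ℕ) : ℤ) := by
    rw [← Equiv.sum_comp (Equiv.addRight (1 : ZMod n))
      (fun i => ((μ (i - 1) : ℕ) : ℤ) * ((ν i : ℕ) : ℤ))]
    simp
  simp only [Emat, mul_sub, Finset.sum_sub_distrib, h]
  simp only [mul_comm]

lemma neg_one_zpow_sum {ι : Type*} (s : Finset ι) (f : ι → ℤ) :
    (-1 : ℝ) ^ (∑ i ∈ s, f i) = ∏ i ∈ s, (-1 : ℝ) ^ f i := by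
  classical
  induction s using Finset.induction_on with
  | empty => simp
  | insert a s ha ih => rw [Finset.sum_insert ha, Finset.prod_insert ha, zpow_add₀ (by simp), ih]

lemma sum_neg_one_zpow_mul (a b c d : Fin 2) :
    ∑ x : Fin 2, (-1 : ℝ) ^ (((x : ℕ) : ℤ) * (((a : ℕ) : ℤ) - ((b : ℕ) : ℤ)) +
      ((x : ℕ) : ℤ) * (((c : ℕ) : ℤ) - ((d : ℕ) : ℤ))) = if a + d = b + c then 2 else 0 := by
  rw [Fin.sum_univ_two]
  fin_cases a <;> fin_cases b <;> fin_cases c <;> fin_cases d <;> norm_num <;> rfl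

lemma ZMod.eq_zero_apply_of_forall_add_one {α : Type*} {n : ℕ} [NeZero n] {f : ZMod n → α}
    (hf : ∀ i, f (i + 1) = f i) (i : ZMod n) : f i = f 0 := by
  have h (k : ℕ) : f k = f 0 := by
    induction k with
    | zero => simp
    | succ k ih => rw [Nat.cast_succ, hf, ih]
  simpa using h i.val

lemma sum_neg_one_zpow_Emat (n : ℕ) [NeZero n] (ρ μ : ZMod n → Fin 2) :
    ∑ ν : ZMod n → Fin 2, (-1 : ℝ) ^ (Emat n ν ρ + Emat n μ ν) =
      if ∀ i, ρ (i + 1) + μ i = ρ i + μ (i - 1) then 2 ^ n else 0 := by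
  simp_rw [Emat_eq_sum_diff_left n μ, Emat, ← Finset.sum_add_distrib, neg_one_zpow_sum]
  have h := Finset.prod_univ_sum (fun _ : ZMod n => (Finset.univ : Finset (Fin 2)))
    (fun i x => (-1 : ℝ) ^ (((x : ℕ) : ℤ) * (((ρ (i + 1) : ℕ) : ℤ) - ((ρ i : ℕ) : ℤ)) +
      ((x : ℕ) : ℤ) * (((μ (i - 1) : ℕ) : ℤ) - ((μ i : ℕ) : ℤ))))
  rw [Fintype.piFinset_univ] at h
  rw [← h]
  simp_rw [sum_neg_one_zpow_mul]
  split_ifs with hc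
  · simp [hc]
  · obtain ⟨i, hi⟩ := not_forall.mp hc
    exact Finset.prod_eq_zero (Finset.mem_univ i) (if_neg hi)

lemma shiftMat_mul_flipMat_apply (n : ℕ) [NeZero n] (ρ μ : ZMod n → Fin 2) :
    (shiftMat n * flipMat n) ρ μ = if ρ = (fun i => 1 - μ (i - 1)) then 1 else 0 := by
  simp [Matrix.mul_apply, shiftMat, flipMat]

lemma forall_add_eq_iff_shift_or_flip (n : ℕ) [NeZero n] (ρ μ : ZMod n → Fin 2) :
    (∀ i, ρ (i + 1) + μ i = ρ i + μ (i - 1)) ↔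
      ρ = (fun i => μ (i - 1)) ∨ ρ = (fun i => 1 - μ (i - 1)) := by
  have add_zero_iff : ∀ a b : Fin 2, a + b = 0 ↔ a = b := by decide
  have add_one_iff : ∀ a b : Fin 2, a + b = 1 ↔ a = 1 - b := by decide
  have zero_or_one : ∀ a : Fin 2, a = 0 ∨ a = 1 := by decide
  have shift_iff : ρ = (fun i => μ (i - 1)) ↔ ∀ i, ρ i + μ (i - 1) = 0 :=
    funext_iff.trans (forall_congr' fun i => (add_zero_iff _ _).symm)
  have flip_iff : ρ = (fun i => 1 - μ (i - 1)) ↔ ∀ i, ρ i + μ (i - 1) = 1 :=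
    funext_iff.trans (forall_congr' fun i => (add_one_iff _ _).symm)
  rw [shift_iff, flip_iff]
  constructor
  · intro h
    have hc := ZMod.eq_zero_apply_of_forall_add_one (f := fun i => ρ i + μ (i - 1))
      (by simpa using h)
    rcases zero_or_one (ρ 0 + μ (0 - 1)) with h0 | h0
    · exact Or.inl fun i => (hc i).trans h0
    · exact Or.inr fun i => (hc i).trans h0
  · rintro (h | h) i <;> simpa [h i] using h (i + 1)

/-- `M₁ · M₁ = (1/2)(T + T·F)`: on flip-invariant vectors, the square of the duality
symmetry `U₁₁` acts as the cyclic shift. -/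
theorem M1_mul_M1 (n : ℕ) [NeZero n] :
    M1 n * M1 n = (1 / 2 : ℝ) • (shiftMat n + shiftMat n * flipMat n) := by
  ext ρ μ
  have hsq : (2 : ℝ) ^ (-(((n : ℝ) + 1) / 2)) * (2 : ℝ) ^ (-(((n : ℝ) + 1) / 2)) * 2 ^ n =
      1 / 2 := by
    rw [← Real.rpow_natCast, ← Real.rpow_add two_pos, ← Real.rpow_add two_pos, one_div,
      ← Real.rpow_neg_one]
    congr 1
    ring
  have hne : ¬ (ρ = (fun i => μ (i - 1)) ∧ ρ = (fun i => 1 - μ (i - 1))) := by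
    rintro ⟨h₁, h₂⟩
    have ne_flip : ∀ a : Fin 2, a ≠ 1 - a := by decide
    exact ne_flip _ (congrFun (h₁.symm.trans h₂) 0)
  have hl : (M1 n * M1 n) ρ μ =
      (2 : ℝ) ^ (-(((n : ℝ) + 1) / 2)) * (2 : ℝ) ^ (-(((n : ℝ) + 1) / 2)) *
        ∑ ν : ZMod n → Fin 2, (-1 : ℝ) ^ (Emat n ν ρ + Emat n μ ν) := by
    rw [Matrix.mul_apply, Finset.mul_sum]
    refine Finset.sum_congr rfl fun ν _ => ?_
    rw [zpow_add₀ (by simp), M1, M1]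
    ring
  rw [hl, sum_neg_one_zpow_Emat, mul_ite, hsq, mul_zero, Matrix.smul_apply, Matrix.add_apply,
    shiftMat_mul_flipMat_apply, shiftMat, smul_eq_mul]
  simp only [forall_add_eq_iff_shift_or_flip]
  by_cases h₁ : ρ = (fun i => μ (i - 1))
  · have h₂ := fun h => hne ⟨h₁, h⟩
    rw [if_pos (Or.inl h₁), if_pos h₁, if_neg h₂, add_zero, mul_one]
  · simp [h₁]
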